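/- Let d ≥ 1 be an integer, α ∈ (1,2], β ∈ ((d+α)/2, d+α), and γ, δ ∈ (0,α). Then there is a constant C, depending only on d, α, β, γ, δ, such that for every t > 0 and all x, y ∈ ℝ^d with |y| ≥ t^{1/α} and |x−y| ≤ min(|x|,|y|)/2: ∫_{ℝ^d} ∫_0^t T^γ_{t−s}(x,z) · |z|^{1−α} · H^{γ,δ}_s(z,y) ds dz ≤ C · |y|^{1−δ} · ( max(|x|,|y|)/t^{1/α} )^{δ−α} · t^{−d/α} · ( t^{1/α}/(t^{1/α} + |x−y|) )^{d+γ}. -/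

import Mathlib

open MeasureTheory

/-- The kernel `T^γ_t(x,z) = min(1, |z|/t^{1/α})^{β−d} · t^{−d/α} ·
(t^{1/α}/(t^{1/α}+|x−z|))^{d+γ}`. -/
noncomputable def Tker (d : ℕ) (α β γ t : ℝ) (x z : EuclideanSpace ℝ (Fin d)) : ℝ :=
  min 1 (‖z‖ / t ^ (1 / α)) ^ (β - d) * t ^ (-(d : ℝ) / α) *
    (t ^ (1 / α) / (t ^ (1 / α) + ‖x - z‖)) ^ ((d : ℝ) + γ)

/-- The kernel `H^{γ,δ}_t(z,y) = t^{−(d+δ)/α} · (t^{1/α}/(t^{1/α}+|z−y|))^{d+γ}`. -/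
noncomputable def Hker (d : ℕ) (α γ δ t : ℝ) (z y : EuclideanSpace ℝ (Fin d)) : ℝ :=
  t ^ (-((d : ℝ) + δ) / α) * (t ^ (1 / α) / (t ^ (1 / α) + ‖z - y‖)) ^ ((d : ℝ) + γ)


noncomputable def Pk (d : ℕ) (γ σ ρ : ℝ) : ℝ :=
  σ ^ (-(d : ℝ)) * (σ / (σ + ρ)) ^ ((d : ℝ) + γ)

lemma Pk_eq (d : ℕ) (γ σ ρ : ℝ) (hσ : 0 < σ) (hρ : 0 ≤ ρ) :
    Pk d γ σ ρ = σ ^ γ * (σ + ρ) ^ (-((d : ℝ) + γ)) := by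
  unfold Pk
  rw [Real.div_rpow hσ.le (by positivity), Real.rpow_neg (by positivity) ((d:ℝ)+γ),
    Real.rpow_add hσ, Real.rpow_neg hσ.le]
  have : σ ^ (d:ℝ) ≠ 0 := by positivity
  field_simp

lemma Pk_nonneg (d : ℕ) (γ σ ρ : ℝ) (hσ : 0 < σ) (hρ : 0 ≤ ρ) : 0 ≤ Pk d γ σ ρ := by
  unfold Pk; positivity

lemma Pk_le (d : ℕ) (γ σ ρ τ r c : ℝ) (hγ : 0 < γ) (hσ : 0 < σ) (hρ : 0 ≤ ρ) (hr : 0 ≤ r)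
    (hc : 0 < c) (hστ : σ ≤ τ) (h : τ + r ≤ c * (σ + ρ)) :
    Pk d γ σ ρ ≤ c ^ ((d : ℝ) + γ) * Pk d γ τ r := by
  have hτ : 0 < τ := hσ.trans_le hστ
  rw [Pk_eq d γ σ ρ hσ hρ, Pk_eq d γ τ r hτ hr]
  have h1 : σ ^ γ ≤ τ ^ γ := Real.rpow_le_rpow hσ.le hστ hγ.le
  have h2 : (σ + ρ) ^ (-((d : ℝ) + γ)) ≤ c ^ ((d : ℝ) + γ) * (τ + r) ^ (-((d : ℝ) + γ)) := by
    have h3 : (c * (σ + ρ)) ^ (-((d : ℝ) + γ)) ≤ (τ + r) ^ (-((d : ℝ) + γ)) :=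
      Real.rpow_le_rpow_of_nonpos (by positivity) h (by
        have : 0 ≤ (d : ℝ) + γ := by positivity
        linarith)
    rw [Real.mul_rpow hc.le (by positivity)] at h3
    have h4 : c ^ ((d : ℝ) + γ) * c ^ (-((d : ℝ) + γ)) = 1 := by
      rw [← Real.rpow_add hc]; simp
    calc (σ + ρ) ^ (-((d : ℝ) + γ))
        = c ^ ((d : ℝ) + γ) * (c ^ (-((d : ℝ) + γ)) * (σ + ρ) ^ (-((d : ℝ) + γ))) := by
          rw [← mul_assoc, h4, one_mul]
      _ ≤ _ := by gcongr
  calc _ ≤ τ ^ γ * (c ^ ((d : ℝ) + γ) * (τ + r) ^ (-((d : ℝ) + γ))) := by gcongr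
    _ = _ := by ring

lemma prod_le_aux (p q X : ℝ) (hp : 0 ≤ p) (hq : 0 ≤ q) (hX : 0 ≤ X) (h : p ≤ X ∨ q ≤ X) :
    p * q ≤ X * (p + q) := by
  rcases h with h | h <;> nlinarith [mul_nonneg hX hp, mul_nonneg hX hq]

lemma threeP (d : ℕ) (γ σ₁ σ₂ τ a b r : ℝ) (hγ : 0 < γ) (h1 : 0 < σ₁) (h2 : 0 < σ₂)
    (h1τ : σ₁ ≤ τ) (h2τ : σ₂ ≤ τ) (hm : τ / 2 ≤ σ₁ ∨ τ / 2 ≤ σ₂)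
    (ha : 0 ≤ a) (hb : 0 ≤ b) (hr : 0 ≤ r) (hab : r ≤ a + b) :
    Pk d γ σ₁ a * Pk d γ σ₂ b ≤
      (4 ^ ((d : ℝ) + γ) * Pk d γ τ r) * (Pk d γ σ₁ a + Pk d γ σ₂ b) := by
  have hτ : 0 < τ := h1.trans_le h1τ
  refine prod_le_aux _ _ _ (Pk_nonneg _ _ _ _ h1 ha) (Pk_nonneg _ _ _ _ h2 hb)
    (mul_nonneg (by positivity) (Pk_nonneg _ _ _ _ hτ hr)) ?_
  have key : τ + r ≤ 4 * (σ₁ + a) ∨ τ + r ≤ 4 * (σ₂ + b) := by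
    by_contra! hcon
    rcases hm with hm | hm <;> linarith
  rcases key with k | k
  · exact Or.inl (Pk_le d γ σ₁ a τ r 4 hγ h1 ha hr (by norm_num) h1τ k)
  · exact Or.inr (Pk_le d γ σ₂ b τ r 4 hγ h2 hb hr (by norm_num) h2τ k)

lemma near_bound (d : ℕ) (γ α e σ₁ σ₂ τ a b r R n : ℝ) (hα : 1 < α) (hγ : 0 < γ) (h1 : 0 < σ₁)
    (h2 : 0 < σ₂) (h1τ : σ₁ ≤ τ) (h2τ : σ₂ ≤ τ) (hm : τ / 2 ≤ σ₁ ∨ τ / 2 ≤ σ₂)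
    (ha : 0 ≤ a) (hb : 0 ≤ b) (hr : 0 ≤ r) (hab : r ≤ a + b) (hτR : τ ≤ R) (hn : R / 4 ≤ n) :
    (min 1 (n / σ₁) ^ e * Pk d γ σ₁ a) * n ^ (1 - α) * Pk d γ σ₂ b ≤
      (4 ^ |e| * 4 ^ (α - 1) * 4 ^ ((d : ℝ) + γ)) * (R ^ (1 - α) * Pk d γ τ r) *
        (Pk d γ σ₁ a + Pk d γ σ₂ b) := by
  have hτ : 0 < τ := h1.trans_le h1τ
  have hR : 0 < R := hτ.trans_le hτR
  have hn0 : 0 < n := by linarith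
  set m := min 1 (n / σ₁) with hmdef
  have hm1 : m ≤ 1 := min_le_left _ _
  have hm4 : 1 / 4 ≤ m := by
    refine le_min (by norm_num) ?_
    rw [le_div_iff₀ h1]; linarith
  have hm0 : 0 < m := by linarith
  have e1 : m ^ e ≤ 4 ^ |e| := by
    calc m ^ e ≤ m ^ (-|e|) := Real.rpow_le_rpow_of_exponent_ge hm0 hm1 (neg_abs_le e)
      _ ≤ (1 / 4) ^ (-|e|) := Real.rpow_le_rpow_of_nonpos (by norm_num) hm4 (by simp)
      _ = 4 ^ |e| := by
        rw [Real.rpow_neg (by norm_num), one_div, Real.inv_rpow (by norm_num), inv_inv]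
  have e2 : n ^ (1 - α) ≤ 4 ^ (α - 1) * R ^ (1 - α) := by
    calc n ^ (1 - α) ≤ (R / 4) ^ (1 - α) :=
          Real.rpow_le_rpow_of_nonpos (by positivity) hn (by linarith)
      _ = _ := by
        rw [Real.div_rpow hR.le (by norm_num), div_eq_mul_inv, ← Real.rpow_neg (by norm_num)]
        rw [mul_comm]; congr 2; ring
  have e3 := threeP d γ σ₁ σ₂ τ a b r hγ h1 h2 h1τ h2τ hm ha hb hr hab
  have p1 := Pk_nonneg d γ σ₁ a h1 ha
  have p2 := Pk_nonneg d γ σ₂ b h2 hb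
  calc (m ^ e * Pk d γ σ₁ a) * n ^ (1 - α) * Pk d γ σ₂ b
      = m ^ e * n ^ (1 - α) * (Pk d γ σ₁ a * Pk d γ σ₂ b) := by ring
    _ ≤ 4 ^ |e| * (4 ^ (α - 1) * R ^ (1 - α)) *
        ((4 ^ ((d : ℝ) + γ) * Pk d γ τ r) * (Pk d γ σ₁ a + Pk d γ σ₂ b)) := by gcongr
    _ = _ := by ring

lemma min_bound (e κ γ σ R n : ℝ) (hκe : κ ≤ e) (hκγ : κ ≤ γ) (hκ : 0 ≤ κ ∨ κ = e) (hγ : 0 < γ)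
    (hσ : 0 < σ) (hσR : σ ≤ R) (hn : 0 < n) (hnR : n ≤ R) :
    min 1 (n / σ) ^ e ≤ (n / R) ^ κ * (R / σ) ^ γ := by
  have hR : 0 < R := hσ.trans_le hσR
  have h1 : 1 ≤ R / σ := by rwa [one_le_div hσ]
  have hm0 : 0 < min 1 (n / σ) := lt_min one_pos (by positivity)
  have hm1 : min 1 (n / σ) ≤ 1 := min_le_left _ _
  rcases le_or_gt 0 κ with h0 | h0
  · calc min 1 (n / σ) ^ e ≤ min 1 (n / σ) ^ κ :=
        Real.rpow_le_rpow_of_exponent_ge hm0 hm1 hκe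
      _ ≤ (n / σ) ^ κ := Real.rpow_le_rpow hm0.le (min_le_right _ _) h0
      _ = (n / R) ^ κ * (R / σ) ^ κ := by
        rw [← Real.mul_rpow (by positivity) (by positivity)]; congr 1; field_simp
      _ ≤ _ := by
        gcongr
  · have hκ' : κ = e := hκ.resolve_left (by linarith)
    subst hκ'
    calc min 1 (n / σ) ^ κ ≤ (n / R) ^ κ := by
          refine Real.rpow_le_rpow_of_nonpos (by positivity) ?_ h0.le
          refine le_min ?_ ?_
          · rwa [div_le_one hR]
          · gcongr
      _ ≤ _ := le_mul_of_one_le_right (by positivity) (Real.one_le_rpow h1 hγ.le)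

lemma far_bound (d : ℕ) (γ α e κ σ₁ σ₂ τ a b r R n : ℝ) (hγ : 0 < γ)
    (hκe : κ ≤ e) (hκγ : κ ≤ γ) (hκ : 0 ≤ κ ∨ κ = e) (h1 : 0 < σ₁)
    (h2 : 0 < σ₂) (h1τ : σ₁ ≤ τ) (h2τ : σ₂ ≤ τ)
    (hr : 0 ≤ r) (hrR : r ≤ R / 2) (hτR : τ ≤ R) (hn0 : 0 < n) (hn : n ≤ R / 4)
    (ha : R / 4 ≤ a) (hb : 3 * R / 4 ≤ b) :
    (min 1 (n / σ₁) ^ e * Pk d γ σ₁ a) * n ^ (1 - α) * Pk d γ σ₂ b ≤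
      (4 ^ ((d : ℝ) + γ) * 4 ^ ((d : ℝ) + γ)) * (R ^ (1 - α) * Pk d γ τ r) *
        (R ^ (-(d : ℝ)) * (n / R) ^ (κ + (1 - α))) := by
  have hτ : 0 < τ := h1.trans_le h1τ
  have hR : 0 < R := hτ.trans_le hτR
  have ha0 : 0 < a := by linarith
  have hb0 : 0 < b := by linarith
  have p2 := Pk_nonneg d γ σ₂ b h2 hb0.le
  have p1 := Pk_nonneg d γ σ₁ a h1 ha0.le
  have e0 := min_bound e κ γ σ₁ R n hκe hκγ hκ hγ h1 (h1τ.trans hτR) hn0 (by linarith)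
  have e2 := Pk_le d γ σ₂ b τ r 4 hγ h2 hb0.le hr (by norm_num) h2τ (by linarith)
  have e1 : Pk d γ σ₁ a ≤ 4 ^ ((d : ℝ) + γ) * (σ₁ ^ γ * R ^ (-((d : ℝ) + γ))) := by
    rw [Pk_eq d γ σ₁ a h1 ha0.le]
    have : (σ₁ + a) ^ (-((d : ℝ) + γ)) ≤ (R / 4) ^ (-((d : ℝ) + γ)) :=
      Real.rpow_le_rpow_of_nonpos (by positivity) (by linarith) (by
        have : 0 ≤ (d : ℝ) + γ := by positivity
        linarith)
    calc _ ≤ σ₁ ^ γ * (R / 4) ^ (-((d : ℝ) + γ)) := by gcongr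
      _ = _ := by
        rw [Real.div_rpow hR.le (by norm_num), Real.rpow_neg (x := 4) (by norm_num), div_inv_eq_mul]
        ring
  have e3 : n ^ (1 - α) = R ^ (1 - α) * (n / R) ^ (1 - α) := by
    rw [← Real.mul_rpow hR.le (by positivity)]; congr 1; field_simp
  have e4 : (R / σ₁) ^ γ * (σ₁ ^ γ * R ^ (-((d : ℝ) + γ))) = R ^ (-(d : ℝ)) := by
    rw [← mul_assoc, ← Real.mul_rpow (by positivity) h1.le, div_mul_cancel₀ _ h1.ne',
      ← Real.rpow_add hR]
    congr 1; ring
  calc (min 1 (n / σ₁) ^ e * Pk d γ σ₁ a) * n ^ (1 - α) * Pk d γ σ₂ b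
      ≤ ((n / R) ^ κ * (R / σ₁) ^ γ * (4 ^ ((d : ℝ) + γ) * (σ₁ ^ γ * R ^ (-((d : ℝ) + γ))))) *
        n ^ (1 - α) * (4 ^ ((d : ℝ) + γ) * Pk d γ τ r) := by gcongr
    _ = (4 ^ ((d : ℝ) + γ) * 4 ^ ((d : ℝ) + γ)) * (R ^ (1 - α) * Pk d γ τ r) *
        (((R / σ₁) ^ γ * (σ₁ ^ γ * R ^ (-((d : ℝ) + γ)))) * ((n / R) ^ κ * (n / R) ^ (1 - α))) := by
          rw [e3]; ring
    _ = _ := by rw [e4, Real.rpow_add (show 0 < n / R by positivity)]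

lemma lintegral_scale (d : ℕ) (f : EuclideanSpace ℝ (Fin d) → ENNReal) (hf : Measurable f)
    (a : EuclideanSpace ℝ (Fin d)) (σ : ℝ) (hσ : 0 < σ) :
    ∫⁻ z, ENNReal.ofReal (σ ^ (-(d : ℝ))) * f (σ⁻¹ • (z - a)) = ∫⁻ z, f z := by
  rw [lintegral_const_mul _ (by fun_prop),
    lintegral_sub_right_eq_self (fun z => f (σ⁻¹ • z)) a]
  have h := Measure.map_addHaar_smul (volume : Measure (EuclideanSpace ℝ (Fin d)))
    (inv_ne_zero hσ.ne')
  have h2 : ∫⁻ z, f (σ⁻¹ • z) = ∫⁻ z, f z ∂(Measure.map (σ⁻¹ • ·) volume) := by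
    rw [lintegral_map hf (by fun_prop)]
  rw [h2, h, lintegral_smul_measure, smul_eq_mul, ← mul_assoc, ← ENNReal.ofReal_mul (by positivity)]
  have : σ ^ (-(d:ℝ)) * |((σ⁻¹) ^ Module.finrank ℝ (EuclideanSpace ℝ (Fin d)))⁻¹| = 1 := by
    rw [abs_of_nonneg (by positivity), finrank_euclideanSpace_fin, Real.rpow_neg hσ.le,
      Real.rpow_natCast]
    rw [inv_pow, inv_inv]
    exact inv_mul_cancel₀ (by positivity)
  rw [this]; simp

lemma Pk_scale (d : ℕ) (γ σ : ℝ) (hσ : 0 < σ) (z a : EuclideanSpace ℝ (Fin d)) :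
    ENNReal.ofReal (Pk d γ σ ‖z - a‖) = ENNReal.ofReal (σ ^ (-(d : ℝ))) *
      (fun w : EuclideanSpace ℝ (Fin d) => ENNReal.ofReal ((1 + ‖w‖) ^ (-((d : ℝ) + γ))))
        (σ⁻¹ • (z - a)) := by
  simp only
  rw [← ENNReal.ofReal_mul (by positivity)]
  congr 1
  unfold Pk
  rw [norm_smul, Real.rpow_neg (by positivity) ((d:ℝ)+γ), ← Real.inv_rpow (by positivity)]
  congr 2
  rw [norm_inv, Real.norm_of_nonneg hσ.le]
  field_simp

lemma ball_finite (d : ℕ) (hd : 1 ≤ d) (m : ℝ) (hm : -(d : ℝ) < m) :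
    ∫⁻ w : EuclideanSpace ℝ (Fin d),
      (Metric.ball 0 1).indicator (fun w => ENNReal.ofReal (‖w‖ ^ m)) w < ⊤ := by
  rw [lintegral_indicator Metric.isOpen_ball.measurableSet]
  have h : IntegrableOn (fun w : EuclideanSpace ℝ (Fin d) => ‖w‖ ^ m) (Metric.ball 0 1) := by
    refine integrableOn_ball_of_norm_le_rpow (C := 1) (α := -m) (by simpa using hd)
      (by rw [finrank_euclideanSpace_fin]; linarith) ?_
      (Measurable.aestronglyMeasurable (by fun_prop))
    refine Filter.Eventually.of_forall fun w => ?_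
    rw [Real.norm_of_nonneg (by positivity)]
    simp
  have := h.2
  rw [HasFiniteIntegral] at this
  refine lt_of_le_of_lt (lintegral_mono fun w => ?_) this
  rw [← ofReal_norm]
  exact ENNReal.ofReal_le_ofReal (le_abs_self _)

lemma time_int (t q : ℝ) (ht : 0 < t) (hq : q < 1) :
    ∫⁻ s in Set.Ioo 0 t, ENNReal.ofReal (s ^ (-q)) = ENNReal.ofReal (t ^ (1 - q) / (1 - q)) := by
  rw [← ofReal_integral_eq_lintegral_ofReal]
  · rw [← integral_Ioc_eq_integral_Ioo, ← intervalIntegral.integral_of_le ht.le,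
      integral_rpow (Or.inl (by linarith)), Real.zero_rpow (by linarith)]
    congr 1
    rw [sub_zero, show -q + 1 = 1 - q by ring]
  · rw [← IntegrableOn, intervalIntegral.integrableOn_Ioo_rpow_iff ht]; linarith
  · filter_upwards [ae_restrict_mem measurableSet_Ioo] with s hs
    exact Real.rpow_nonneg hs.1.le _

lemma Tker_eq (d : ℕ) (α β γ u : ℝ) (hu : 0 < u) (x z : EuclideanSpace ℝ (Fin d)) :
    Tker d α β γ u x z =
      min 1 (‖z‖ / u ^ (1 / α)) ^ (β - d) * Pk d γ (u ^ (1 / α)) ‖z - x‖ := by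
  unfold Tker Pk
  rw [mul_assoc, ← Real.rpow_mul hu.le, norm_sub_rev x z]
  congr 3
  ring_nf

lemma Hker_eq (d : ℕ) (α γ δ u : ℝ) (hu : 0 < u) (z y : EuclideanSpace ℝ (Fin d)) :
    Hker d α γ δ u z y = u ^ (-(δ / α)) * Pk d γ (u ^ (1 / α)) ‖z - y‖ := by
  unfold Hker Pk
  rw [← mul_assoc, ← Real.rpow_mul hu.le, ← Real.rpow_add hu]
  congr 2
  ring

/-- Pointwise bound of the integrand. -/
lemma pointwise_bound (d : ℕ) (α β γ δ κ t s : ℝ) (hα : 1 < α) (hγ : 0 < γ)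
    (hκe : κ ≤ β - d) (hκγ : κ ≤ γ) (hκ : 0 ≤ κ ∨ κ = β - d)
    (hs : 0 < s) (hst : s < t) (x y z : EuclideanSpace ℝ (Fin d))
    (hy : t ^ (1 / α) ≤ ‖y‖) (hxy : ‖x - y‖ ≤ ‖y‖ / 2) :
    ENNReal.ofReal (Tker d α β γ (t - s) x z * ‖z‖ ^ (1 - α) * Hker d α γ δ s z y) ≤
      ENNReal.ofReal ((4 ^ |β - d| * 4 ^ (α - 1) * 4 ^ ((d : ℝ) + γ) +
          4 ^ ((d : ℝ) + γ) * 4 ^ ((d : ℝ) + γ)) *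
          (‖y‖ ^ (1 - α) * Pk d γ (t ^ (1 / α)) ‖x - y‖)) *
        ENNReal.ofReal (s ^ (-(δ / α))) *
        (ENNReal.ofReal (Pk d γ ((t - s) ^ (1 / α)) ‖z - x‖) +
          ENNReal.ofReal (Pk d γ (s ^ (1 / α)) ‖z - y‖) +
          ENNReal.ofReal (‖y‖ ^ (-(d : ℝ))) *
            (Metric.ball (0 : EuclideanSpace ℝ (Fin d)) 1).indicator
              (fun w => ENNReal.ofReal (‖w‖ ^ (κ + (1 - α)))) (‖y‖⁻¹ • (z - 0))) := by
  have ht : 0 < t := hs.trans hst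
  have hts : 0 < t - s := by linarith
  have hα0 : 0 < α := by linarith
  have hia : 0 ≤ 1 / α := by positivity
  rw [Tker_eq d α β γ _ hts, Hker_eq d α γ δ s hs]
  set σ₁ := (t - s) ^ (1 / α) with hσ₁
  set σ₂ := s ^ (1 / α) with hσ₂
  set τ := t ^ (1 / α) with hτdef
  set R := ‖y‖ with hRdef
  have h1 : 0 < σ₁ := Real.rpow_pos_of_pos hts _
  have h2 : 0 < σ₂ := Real.rpow_pos_of_pos hs _
  have hτ : 0 < τ := Real.rpow_pos_of_pos ht _
  have hR : 0 < R := hτ.trans_le hy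
  have h1τ : σ₁ ≤ τ := Real.rpow_le_rpow hts.le (by linarith) hia
  have h2τ : σ₂ ≤ τ := Real.rpow_le_rpow hs.le hst.le hia
  have half : τ / 2 ≤ (t / 2) ^ (1 / α) := by
    rw [Real.div_rpow ht.le (by norm_num)]
    have : (2 : ℝ) ^ (1 / α) ≤ 2 ^ (1 : ℝ) :=
      Real.rpow_le_rpow_of_exponent_le (by norm_num) (by rw [div_le_one hα0]; exact hα.le)
    rw [Real.rpow_one] at this
    gcongr
  have hm : τ / 2 ≤ σ₁ ∨ τ / 2 ≤ σ₂ := by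
    rcases le_total (t / 2) s with h | h
    · exact Or.inr (half.trans (Real.rpow_le_rpow (by positivity) h hia))
    · exact Or.inl (half.trans (Real.rpow_le_rpow (by positivity) (by linarith) hia))
  have hab : ‖x - y‖ ≤ ‖z - x‖ + ‖z - y‖ := by
    have := norm_sub_le_norm_sub_add_norm_sub x z y
    rwa [norm_sub_rev x z] at this
  have p1 := Pk_nonneg d γ σ₁ ‖z - x‖ h1 (norm_nonneg _)
  have p2 := Pk_nonneg d γ σ₂ ‖z - y‖ h2 (norm_nonneg _)
  have p3 := Pk_nonneg d γ τ ‖x - y‖ hτ (norm_nonneg _)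
  have ps : 0 ≤ s ^ (-(δ / α)) := by positivity
  set K₁ : ℝ := 4 ^ |β - d| * 4 ^ (α - 1) * 4 ^ ((d : ℝ) + γ) with hK₁
  set K₂ : ℝ := 4 ^ ((d : ℝ) + γ) * 4 ^ ((d : ℝ) + γ) with hK₂
  have hK₁0 : 0 ≤ K₁ := by positivity
  have hK₂0 : 0 ≤ K₂ := by positivity
  set A := R ^ (1 - α) * Pk d γ τ ‖x - y‖ with hA
  have hA0 : 0 ≤ A := by positivity
  rcases le_or_gt (R / 4) ‖z‖ with hn | hn
  · have key := near_bound d γ α (β - d) σ₁ σ₂ τ ‖z - x‖ ‖z - y‖ ‖x - y‖ R ‖z‖ hα hγ h1 h2 h1τ h2τ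
      hm (norm_nonneg _) (norm_nonneg _) (norm_nonneg _) hab hy hn
    rw [← hK₁, ← hA] at key
    calc _ ≤ ENNReal.ofReal ((K₁ + K₂) * A * s ^ (-(δ / α)) *
            (Pk d γ σ₁ ‖z - x‖ + Pk d γ σ₂ ‖z - y‖)) := by
          apply ENNReal.ofReal_le_ofReal
          calc _ = s ^ (-(δ / α)) * (min 1 (‖z‖ / σ₁) ^ (β - d) * Pk d γ σ₁ ‖z - x‖ *
                ‖z‖ ^ (1 - α) * Pk d γ σ₂ ‖z - y‖) := by ring
            _ ≤ s ^ (-(δ / α)) * (K₁ * A * (Pk d γ σ₁ ‖z - x‖ + Pk d γ σ₂ ‖z - y‖)) := by gcongr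
            _ ≤ s ^ (-(δ / α)) *
                ((K₁ + K₂) * A * (Pk d γ σ₁ ‖z - x‖ + Pk d γ σ₂ ‖z - y‖)) := by
              gcongr; linarith
            _ = _ := by ring
      _ = ENNReal.ofReal ((K₁ + K₂) * A) * ENNReal.ofReal (s ^ (-(δ / α))) *
            (ENNReal.ofReal (Pk d γ σ₁ ‖z - x‖) + ENNReal.ofReal (Pk d γ σ₂ ‖z - y‖)) := by
          rw [ENNReal.ofReal_mul (by positivity), ENNReal.ofReal_mul (by positivity),
            ENNReal.ofReal_add p1 p2]
      _ ≤ _ := by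
          exact mul_le_mul_right le_self_add _
  · rcases eq_or_ne z 0 with hz | hz
    · rw [hz, norm_zero, Real.zero_rpow (by linarith : (1 - α) ≠ 0)]
      simp
    have hn0 : 0 < ‖z‖ := norm_pos_iff.mpr hz
    have hxR : R / 2 ≤ ‖x‖ := by
      have := norm_sub_norm_le y x
      rw [norm_sub_rev] at this
      linarith
    have ha : R / 4 ≤ ‖z - x‖ := by
      have := norm_sub_norm_le x z
      rw [norm_sub_rev] at this
      linarith
    have hb : 3 * R / 4 ≤ ‖z - y‖ := by
      have := norm_sub_norm_le y z
      rw [norm_sub_rev] at this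
      linarith
    have key := far_bound d γ α (β - d) κ σ₁ σ₂ τ ‖z - x‖ ‖z - y‖ ‖x - y‖ R ‖z‖ hγ hκe hκγ hκ
      h1 h2 h1τ h2τ (norm_nonneg _) hxy hy hn0 hn.le ha hb
    rw [← hK₂, ← hA] at key
    have hmem : R⁻¹ • (z - 0) ∈ Metric.ball (0 : EuclideanSpace ℝ (Fin d)) 1 := by
      rw [mem_ball_zero_iff, sub_zero, norm_smul, norm_inv, Real.norm_of_nonneg hR.le,
        inv_mul_lt_iff₀ hR]
      linarith
    rw [Set.indicator_of_mem hmem]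
    have hnorm : ‖R⁻¹ • (z - 0)‖ = ‖z‖ / R := by
      rw [sub_zero, norm_smul, norm_inv, Real.norm_of_nonneg hR.le]
      ring
    rw [hnorm]
    calc _ ≤ ENNReal.ofReal ((K₁ + K₂) * A * s ^ (-(δ / α)) *
            (R ^ (-(d : ℝ)) * (‖z‖ / R) ^ (κ + (1 - α)))) := by
          apply ENNReal.ofReal_le_ofReal
          calc _ = s ^ (-(δ / α)) * (min 1 (‖z‖ / σ₁) ^ (β - d) * Pk d γ σ₁ ‖z - x‖ *
                ‖z‖ ^ (1 - α) * Pk d γ σ₂ ‖z - y‖) := by ring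
            _ ≤ s ^ (-(δ / α)) * (K₂ * A * (R ^ (-(d : ℝ)) * (‖z‖ / R) ^ (κ + (1 - α)))) := by
              gcongr
            _ ≤ s ^ (-(δ / α)) *
                ((K₁ + K₂) * A * (R ^ (-(d : ℝ)) * (‖z‖ / R) ^ (κ + (1 - α)))) := by
              gcongr; linarith
            _ = _ := by ring
      _ = ENNReal.ofReal ((K₁ + K₂) * A) * ENNReal.ofReal (s ^ (-(δ / α))) *
            (ENNReal.ofReal (R ^ (-(d : ℝ))) * ENNReal.ofReal ((‖z‖ / R) ^ (κ + (1 - α)))) := by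
          rw [ENNReal.ofReal_mul (p := (K₁ + K₂) * A * s ^ (-(δ / α))) (by positivity),
            ENNReal.ofReal_mul (p := (K₁ + K₂) * A) (by positivity),
            ENNReal.ofReal_mul (p := R ^ (-(d : ℝ))) (by positivity)]
      _ ≤ _ := by
          exact mul_le_mul_right le_add_self _

lemma rhs_bound (α δ τ R X : ℝ) (hδ : δ < α) (hτ : 0 < τ) (hR : 0 < R)
    (hX : R ≤ X) (hX2 : X ≤ 2 * R) :
    R ^ (1 - α) * τ ^ (α - δ) ≤ 2 ^ (α - δ) * (R ^ (1 - δ) * (X / τ) ^ (δ - α)) := by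
  have hX0 : 0 < X := hR.trans_le hX
  have h : (2 * R / τ) ^ (δ - α) ≤ (X / τ) ^ (δ - α) :=
    Real.rpow_le_rpow_of_nonpos (by positivity) (by gcongr) (by linarith)
  have e : (2 * R / τ) ^ (δ - α) = (2 ^ (α - δ))⁻¹ * R ^ (δ - α) * τ ^ (α - δ) := by
    rw [Real.div_rpow (by positivity) hτ.le, Real.mul_rpow (by norm_num) hR.le,
      show α - δ = -(δ - α) by ring, Real.rpow_neg (by norm_num), Real.rpow_neg hτ.le, inv_inv,
      div_eq_mul_inv]
  have e2 : R ^ (1 - α) = R ^ (1 - δ) * R ^ (δ - α) := by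
    rw [← Real.rpow_add hR]; congr 1; ring
  have h20 : (2 : ℝ) ^ (α - δ) ≠ 0 := by positivity
  calc R ^ (1 - α) * τ ^ (α - δ) = 2 ^ (α - δ) * (R ^ (1 - δ) * (2 * R / τ) ^ (δ - α)) := by
        rw [e, e2]; field_simp
    _ ≤ _ := by gcongr

/-- Lemma 4.2 of the paper: the Duhamel-type integral of `T^γ_{t−s}(x,z) |z|^{1−α}
H^{γ,δ}_s(z,y)` is dominated by `|y|^{1−δ} M^{γ,δ}_t(x,y)` in the region
`|y| ≥ t^{1/α}`, `|x−y| ≤ min(|x|,|y|)/2`. -/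
theorem duhamel_integral_cancellation_region
    (d : ℕ) (hd : 1 ≤ d) (α β γ δ : ℝ)
    (hα1 : 1 < α) (hα2 : α ≤ 2)
    (hβ1 : ((d : ℝ) + α) / 2 < β) (hβ2 : β < (d : ℝ) + α)
    (hγ1 : 0 < γ) (hγ2 : γ < α) (hδ1 : 0 < δ) (hδ2 : δ < α) :
    ∃ C : ℝ, 0 < C ∧
      ∀ t : ℝ, 0 < t → ∀ x y : EuclideanSpace ℝ (Fin d),
        t ^ (1 / α) ≤ ‖y‖ → ‖x - y‖ ≤ min ‖x‖ ‖y‖ / 2 →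
        (∫⁻ z, ∫⁻ s in Set.Ioo (0 : ℝ) t,
            ENNReal.ofReal
              (Tker d α β γ (t - s) x z * ‖z‖ ^ (1 - α) * Hker d α γ δ s z y))
          ≤ ENNReal.ofReal
              (C * ‖y‖ ^ (1 - δ) * (max ‖x‖ ‖y‖ / t ^ (1 / α)) ^ (δ - α) *
                t ^ (-(d : ℝ) / α) *
                (t ^ (1 / α) / (t ^ (1 / α) + ‖x - y‖)) ^ ((d : ℝ) + γ)) := by
  classical
  have hα0 : 0 < α := by linarith
  have hq : δ / α < 1 := by rwa [div_lt_one hα0]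
  obtain ⟨κ, hκe, hκγ, hκ, hκm⟩ : ∃ κ : ℝ, κ ≤ β - d ∧ κ ≤ γ ∧ (0 ≤ κ ∨ κ = β - d) ∧
      -(d : ℝ) < κ + (1 - α) := by
    have hd' : (1 : ℝ) ≤ d := by exact_mod_cast hd
    rcases le_total (β - d) γ with h | h
    · exact ⟨β - d, le_rfl, h, Or.inr rfl, by linarith⟩
    · exact ⟨γ, h, le_rfl, Or.inl hγ1.le, by linarith⟩
  set g : EuclideanSpace ℝ (Fin d) → ENNReal :=
    fun w => ENNReal.ofReal ((1 + ‖w‖) ^ (-((d : ℝ) + γ))) with hg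
  set f : EuclideanSpace ℝ (Fin d) → ENNReal :=
    (Metric.ball (0 : EuclideanSpace ℝ (Fin d)) 1).indicator
      (fun w => ENNReal.ofReal (‖w‖ ^ (κ + (1 - α)))) with hf
  have hgm : Measurable g := by fun_prop
  have hfm : Measurable f :=
    Measurable.indicator (by fun_prop) Metric.isOpen_ball.measurableSet
  have hgfin : ∫⁻ w, g w < ⊤ :=
    finite_integral_one_add_norm (by rw [finrank_euclideanSpace_fin]; linarith)
  have hffin : ∫⁻ w, f w < ⊤ := ball_finite d hd _ hκm
  set J : ENNReal := (∫⁻ w, g w) + (∫⁻ w, g w) + ∫⁻ w, f w with hJ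
  have hJfin : J ≠ ⊤ := by
    rw [hJ]
    exact (ENNReal.add_lt_top.2 ⟨ENNReal.add_lt_top.2 ⟨hgfin, hgfin⟩, hffin⟩).ne
  obtain ⟨j, hJ0, hJj⟩ : ∃ j : ℝ, 0 ≤ j ∧ J = ENNReal.ofReal j :=
    ⟨J.toReal, ENNReal.toReal_nonneg, (ENNReal.ofReal_toReal hJfin).symm⟩
  set K : ℝ := 4 ^ |β - d| * 4 ^ (α - 1) * 4 ^ ((d : ℝ) + γ) +
          4 ^ ((d : ℝ) + γ) * 4 ^ ((d : ℝ) + γ) with hK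
  have hK0 : 0 < K := by positivity
  have h1q : 0 < 1 - δ / α := by linarith
  refine ⟨K * (2 ^ (α - δ) / (1 - δ / α)) * (j + 1), by positivity, ?_⟩
  intro t ht x y hy hxy
  have hτ : 0 < t ^ (1 / α) := Real.rpow_pos_of_pos ht _
  have hR : 0 < ‖y‖ := hτ.trans_le hy
  have hxy' : ‖x - y‖ ≤ ‖y‖ / 2 := hxy.trans (by gcongr; exact min_le_right _ _)
  have hP := Pk_nonneg d γ (t ^ (1 / α)) ‖x - y‖ hτ (norm_nonneg _)
  set A : ℝ := K * (‖y‖ ^ (1 - α) * Pk d γ (t ^ (1 / α)) ‖x - y‖) with hA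
  have hA0 : 0 ≤ A := by positivity
  have step1 : (∫⁻ z, ∫⁻ s in Set.Ioo (0 : ℝ) t,
            ENNReal.ofReal
              (Tker d α β γ (t - s) x z * ‖z‖ ^ (1 - α) * Hker d α γ δ s z y)) ≤
      ∫⁻ z, ∫⁻ s in Set.Ioo (0 : ℝ) t,
        ENNReal.ofReal A * ENNReal.ofReal (s ^ (-(δ / α))) *
        (ENNReal.ofReal (Pk d γ ((t - s) ^ (1 / α)) ‖z - x‖) +
          ENNReal.ofReal (Pk d γ (s ^ (1 / α)) ‖z - y‖) +
          ENNReal.ofReal (‖y‖ ^ (-(d : ℝ))) * f (‖y‖⁻¹ • (z - 0))) := by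
    refine lintegral_mono fun z => setLIntegral_mono' measurableSet_Ioo fun s hs => ?_
    exact pointwise_bound d α β γ δ κ t s hα1 hγ1 hκe hκγ hκ hs.1 hs.2 x y z hy hxy'
  refine step1.trans ?_
  rw [lintegral_lintegral_swap (by
    apply Measurable.aemeasurable
    unfold Pk Function.uncurry
    fun_prop)]
  have step2 : ∀ s ∈ Set.Ioo (0 : ℝ) t,
      ∫⁻ z, ENNReal.ofReal A * ENNReal.ofReal (s ^ (-(δ / α))) *
        (ENNReal.ofReal (Pk d γ ((t - s) ^ (1 / α)) ‖z - x‖) +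
          ENNReal.ofReal (Pk d γ (s ^ (1 / α)) ‖z - y‖) +
          ENNReal.ofReal (‖y‖ ^ (-(d : ℝ))) * f (‖y‖⁻¹ • (z - 0))) =
      ENNReal.ofReal A * J * ENNReal.ofReal (s ^ (-(δ / α))) := by
    intro s hs
    have hts : 0 < (t - s) ^ (1 / α) := Real.rpow_pos_of_pos (by linarith [hs.2]) _
    have hs0 : 0 < s ^ (1 / α) := Real.rpow_pos_of_pos hs.1 _
    rw [lintegral_const_mul _ (by unfold Pk; fun_prop),
      lintegral_add_left (by unfold Pk; fun_prop), lintegral_add_left (by unfold Pk; fun_prop),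
      lintegral_scale d f hfm 0 ‖y‖ hR]
    simp_rw [Pk_scale d γ _ hts, Pk_scale d γ _ hs0]
    rw [lintegral_scale d g hgm x _ hts, lintegral_scale d g hgm y _ hs0, ← hJ]
    ring
  rw [setLIntegral_congr_fun measurableSet_Ioo step2, lintegral_const_mul _ (by fun_prop),
    time_int t _ ht hq, hJj, ← ENNReal.ofReal_mul hA0,
    ← ENNReal.ofReal_mul (by positivity)]
  apply ENNReal.ofReal_le_ofReal
  have hmx : max ‖x‖ ‖y‖ ≤ 2 * ‖y‖ := by
    refine max_le ?_ (by linarith)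
    have := norm_sub_norm_le x y
    linarith
  have key := rhs_bound α δ (t ^ (1 / α)) ‖y‖ (max ‖x‖ ‖y‖) hδ2 hτ hR (le_max_right _ _) hmx
  have htt : t ^ (1 - δ / α) = (t ^ (1 / α)) ^ (α - δ) := by
    rw [← Real.rpow_mul ht.le]; congr 1; field_simp
  have htd : t ^ (-(d : ℝ) / α) = (t ^ (1 / α)) ^ (-(d : ℝ)) := by
    rw [← Real.rpow_mul ht.le]; congr 1; ring
  rw [htt, htd]
  calc A * j * ((t ^ (1 / α)) ^ (α - δ) / (1 - δ / α))
      = (K * (1 / (1 - δ / α)) * j) * Pk d γ (t ^ (1 / α)) ‖x - y‖ *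
        (‖y‖ ^ (1 - α) * (t ^ (1 / α)) ^ (α - δ)) := by rw [hA]; ring
    _ ≤ (K * (1 / (1 - δ / α)) * (j + 1)) * Pk d γ (t ^ (1 / α)) ‖x - y‖ *
        (2 ^ (α - δ) * (‖y‖ ^ (1 - δ) * (max ‖x‖ ‖y‖ / t ^ (1 / α)) ^ (δ - α))) := by
      gcongr
      linarith
    _ = _ := by unfold Pk; ring
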